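/- Let A : Matrix (Fin n) (Fin n) ℝ be a matrix with nonnegative off-diagonal entries (A i j ≥ 0 for all i ≠ j) and every column summing to zero (∀ j, ∑ i, A i j = 0), let τ > 0, and let u⁰ : Fin n → ℝ be entrywise nonnegative. Define the implicit Euler iterates by u^{k+1} = (I − τ • A)⁻¹.mulVec u^k. Then for every k ∈ ℕ, the iterate u^k is entrywise nonnegative and has the same mass as the initial datum: ∑ i, u^k i = ∑ i, u⁰ i. -/

import Mathlib

open Matrix Finset

/-- If the off-diagonal entries of `A` are nonnegative and its columns sum to zero, then
`1 - τ • A` is inverse-nonnegative: a vector with nonnegative image is nonnegative. -/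
theorem nonneg_of_one_sub_smul_mulVec_nonneg {ι : Type*} [Fintype ι] [DecidableEq ι]
    {A : Matrix ι ι ℝ} (hoff : ∀ i j, i ≠ j → 0 ≤ A i j) (hcol : ∀ j, ∑ i, A i j = 0)
    {τ : ℝ} (hτ : 0 ≤ τ) {v : ι → ℝ} (hv : ∀ i, 0 ≤ ((1 - τ • A).mulVec v) i) (i : ι) :
    0 ≤ v i := by
  set S := Finset.univ.filter (fun i => v i < 0) with hS
  have hA : 0 ≤ ∑ i ∈ S, (A.mulVec v) i := by
    simp only [Matrix.mulVec, dotProduct]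
    rw [Finset.sum_comm]
    refine Finset.sum_nonneg fun j _ => ?_
    rw [← Finset.sum_mul]
    by_cases hj : v j < 0
    · refine mul_nonneg_of_nonpos_of_nonpos ?_ hj.le
      have hcompl : 0 ≤ ∑ i ∈ Sᶜ, A i j := Finset.sum_nonneg fun i hi => hoff i j <| by
        rintro rfl
        simp [hS, hj.not_ge] at hi
      linarith [Finset.sum_add_sum_compl S (fun i => A i j), hcol j]
    · refine mul_nonneg (Finset.sum_nonneg fun i hi => hoff i j ?_) (not_lt.mp hj)
      rintro rfl
      simp [hS, hj] at hi
  have hsum : 0 ≤ ∑ i ∈ S, ((1 - τ • A).mulVec v) i := Finset.sum_nonneg fun i _ => hv i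
  simp only [Matrix.sub_mulVec, Matrix.one_mulVec, Matrix.smul_mulVec, Pi.sub_apply,
    Pi.smul_apply, smul_eq_mul, Finset.sum_sub_distrib, ← Finset.mul_sum] at hsum
  by_contra! hi
  have hneg : ∑ i ∈ S, v i < 0 :=
    Finset.sum_neg (fun j hj => (Finset.mem_filter.mp hj).2) ⟨i, by simp [hS, hi]⟩
  linarith [mul_nonneg hτ hA]

/-- If the off-diagonal entries of `A` are nonnegative and its columns sum to zero, then
`1 - τ • A` is invertible for every `τ ≥ 0`. -/
theorem isUnit_one_sub_smul {ι : Type*} [Fintype ι] [DecidableEq ι]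
    {A : Matrix ι ι ℝ} (hoff : ∀ i j, i ≠ j → 0 ≤ A i j) (hcol : ∀ j, ∑ i, A i j = 0)
    {τ : ℝ} (hτ : 0 ≤ τ) : IsUnit (1 - τ • A) := by
  rw [← Matrix.mulVec_injective_iff_isUnit]
  intro v w hvw
  have hle : ∀ x y : ι → ℝ, (1 - τ • A).mulVec x = (1 - τ • A).mulVec y → x ≤ y := by
    intro x y hxy i
    have := nonneg_of_one_sub_smul_mulVec_nonneg hoff hcol hτ (v := y - x)
      (fun i => by simp [Matrix.mulVec_sub, hxy]) i
    simpa using this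
  exact le_antisymm (hle v w hvw) (hle w v hvw.symm)

/-- If the columns of `A` sum to zero, then `1 - τ • A` preserves the sum of the entries. -/
theorem sum_one_sub_smul_mulVec {ι : Type*} [Fintype ι] [DecidableEq ι]
    {A : Matrix ι ι ℝ} (hcol : ∀ j, ∑ i, A i j = 0) (τ : ℝ) (v : ι → ℝ) :
    ∑ i, ((1 - τ • A).mulVec v) i = ∑ i, v i := by
  have hA : ∑ i, (A.mulVec v) i = 0 := by
    simp only [Matrix.mulVec, dotProduct]
    rw [Finset.sum_comm]
    simp [← Finset.sum_mul, hcol]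
  simp [Matrix.sub_mulVec, Matrix.smul_mulVec, ← Finset.mul_sum, hA]

theorem implicit_euler_iterates_scale_space (n : ℕ) (A : Matrix (Fin n) (Fin n) ℝ)
    (hoff : ∀ i j, i ≠ j → 0 ≤ A i j) (hcol : ∀ j, ∑ i, A i j = 0)
    (τ : ℝ) (hτ : 0 < τ) (u0 : Fin n → ℝ) (hu0 : ∀ i, 0 ≤ u0 i)
    (u : ℕ → Fin n → ℝ) (h0 : u 0 = u0)
    (hrec : ∀ k, u (k + 1) = (1 - τ • A)⁻¹.mulVec (u k)) :
    ∀ k, (∀ i, 0 ≤ u k i) ∧ ∑ i, u k i = ∑ i, u0 i := by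
  have hunit := (Matrix.isUnit_iff_isUnit_det _).mp (isUnit_one_sub_smul hoff hcol hτ.le)
  have hstep : ∀ k, (1 - τ • A).mulVec (u (k + 1)) = u k := fun k => by
    rw [hrec, Matrix.mulVec_mulVec, Matrix.mul_nonsing_inv _ hunit, Matrix.one_mulVec]
  intro k
  induction k with
  | zero => exact ⟨by simpa only [h0] using hu0, by rw [h0]⟩
  | succ k ih =>
    refine ⟨nonneg_of_one_sub_smul_mulVec_nonneg hoff hcol hτ.le ?_, ?_⟩
    · rw [hstep]
      exact ih.1
    · rw [← sum_one_sub_smul_mulVec hcol τ, hstep, ih.2]
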